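/- Let n ∈ ℕ, let I ⊆ ℝ be an interval, and let f, g : I → ℝ. The following conditions are equivalent: (i) there exists a polynomial w of degree at most n such that f(x) ≤ w(x) ≤ g(x) for all x ∈ I; (ii) f(b) ≤ g(b) whenever b ∈ I is the right endpoint of I (if I contains its right endpoint), and for every x₀, x₁, …, x_{n+1} ∈ I with x₀ ≤ x₁ < x₂ < ⋯ < x_{n+1} the two inequalities hold: f(x₀) ≤ Σ_{i odd} cᵢ(x₀; x₁,…,x_{n+1}) g(xᵢ) + Σ_{i even} cᵢ(x₀; x₁,…,x_{n+1}) f(xᵢ), and g(x₀) ≥ Σ_{i odd} cᵢ(x₀; x₁,…,x_{n+1}) f(xᵢ) + Σ_{i even} cᵢ(x₀; x₁,…,x_{n+1}) g(xᵢ), where the sums range over i = 1,…,n+1. -/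

import Mathlib

/-- Lagrange basis coefficient: `lagC t z i = ∏_{j ≠ i} (t - z j)/(z i - z j)`. -/
noncomputable def lagC {m : ℕ} (t : ℝ) (z : Fin m → ℝ) (i : Fin m) : ℝ :=
  ∏ j ∈ Finset.univ.erase i, (t - z j) / (z i - z j)

theorem eval_lagrangeBasis_eq_lagC {m : ℕ} (t : ℝ) (z : Fin m → ℝ) (i : Fin m) :
    (Lagrange.basis Finset.univ z i).eval t = lagC t z i := by
  simp only [Lagrange.basis, Lagrange.basisDivisor, lagC, Polynomial.eval_prod]
  refine Finset.prod_congr rfl fun j _ => ?_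
  simp [div_eq_inv_mul]

theorem eval_interpolate_eq_sum_lagC {m : ℕ} (t : ℝ) (z v : Fin m → ℝ) :
    (Lagrange.interpolate Finset.univ z v).eval t = ∑ i, lagC t z i * v i := by
  simp [Lagrange.interpolate_apply, Polynomial.eval_finsetSum, eval_lagrangeBasis_eq_lagC,
    mul_comm]

theorem eval_eq_sum_lagC {n : ℕ} {z : Fin (n + 1) → ℝ} (hz : Function.Injective z)
    {w : Polynomial ℝ} (hw : w.natDegree ≤ n) (t : ℝ) :
    w.eval t = ∑ i, lagC t z i * w.eval (z i) := by
  rw [← eval_interpolate_eq_sum_lagC t z fun i => w.eval (z i)]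
  congr 1
  refine Lagrange.eq_interpolate hz.injOn ?_
  rw [Finset.card_fin]
  exact Polynomial.degree_le_natDegree.trans_lt (by exact_mod_cast Nat.lt_succ_of_le hw)

theorem natDegree_interpolate_le {n : ℕ} {z : Fin (n + 1) → ℝ} (hz : Function.Injective z)
    (v : Fin (n + 1) → ℝ) : (Lagrange.interpolate Finset.univ z v).natDegree ≤ n := by
  have h := Lagrange.degree_interpolate_le (s := Finset.univ) v hz.injOn
  rw [Finset.card_fin] at h
  exact Polynomial.natDegree_le_of_degree_le (by simpa using h)

theorem lagC_node {m : ℕ} {z : Fin m → ℝ} (hz : Function.Injective z) (i j : Fin m) :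
    lagC (z j) z i = if i = j then 1 else 0 := by
  rw [← eval_lagrangeBasis_eq_lagC]
  split_ifs with h
  · subst h; exact Lagrange.eval_basis_self hz.injOn (Finset.mem_univ _)
  · exact Lagrange.eval_basis_of_ne h (Finset.mem_univ _)

/-- To the left of all nodes the Lagrange basis coefficients alternate in sign. -/
theorem neg_one_pow_mul_lagC_nonneg {m : ℕ} {t : ℝ} {z : Fin m → ℝ} (hz : StrictMono z)
    (ht : ∀ j, t ≤ z j) (i : Fin m) : 0 ≤ (-1) ^ (i : ℕ) * lagC t z i := by
  have hsign : ((-1 : ℝ)) ^ (i : ℕ) =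
      ∏ j ∈ Finset.univ.erase i, if j < i then (-1 : ℝ) else 1 := by
    rw [Finset.prod_ite]
    have : (Finset.univ.erase i).filter (· < i) = Finset.Iio i := by
      ext j
      simpa using ne_of_lt
    simp [this]
  rw [hsign, lagC, ← Finset.prod_mul_distrib]
  refine Finset.prod_nonneg fun j hj => ?_
  have htj := ht j
  rcases lt_or_gt_of_ne (Finset.ne_of_mem_erase hj) with h | h
  · have := hz h
    rw [if_pos h, neg_one_mul, neg_nonneg]
    exact div_nonpos_of_nonpos_of_nonneg (by linarith) (by linarith)
  · have := hz h
    rw [if_neg h.not_gt, one_mul]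
    exact div_nonneg_of_nonpos (by linarith) (by linarith)

/-- The two inequalities at `x` say exactly that a linear functional vanishing on the values of
polynomials of degree at most `n` has no strict sign on the box `∏ [f (x i), g (x i)]`. -/
theorem exists_separating_polynomial_of_points {n : ℕ} {f g : ℝ → ℝ} {x : Fin (n + 2) → ℝ}
    (hfg : ∀ i, f (x i) ≤ g (x i))
    (hx : StrictMono (fun i : Fin (n + 1) => x i.succ))
    (hlo : f (x 0) ≤ ∑ i : Fin (n + 1), lagC (x 0) (fun j => x j.succ) i *
            (if Odd ((i : ℕ) + 1) then g (x i.succ) else f (x i.succ)))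
    (hhi : g (x 0) ≥ ∑ i : Fin (n + 1), lagC (x 0) (fun j => x j.succ) i *
            (if Odd ((i : ℕ) + 1) then f (x i.succ) else g (x i.succ))) :
    ∃ w : Polynomial ℝ, w.natDegree ≤ n ∧
      ∀ i, f (x i) ≤ w.eval (x i) ∧ w.eval (x i) ≤ g (x i) := by
  set z : Fin (n + 1) → ℝ := fun j => x j.succ
  set lo : Fin (n + 1) → ℝ := fun i => if Odd ((i : ℕ) + 1) then g (x i.succ) else f (x i.succ)
  set hi : Fin (n + 1) → ℝ := fun i => if Odd ((i : ℕ) + 1) then f (x i.succ) else g (x i.succ)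
  set A := ∑ i, lagC (x 0) z i * lo i with hA
  set B := ∑ i, lagC (x 0) z i * hi i with hB
  obtain ⟨s, hs0, hs1, hs⟩ : ∃ s : ℝ, 0 ≤ s ∧ s ≤ 1 ∧
      (1 - s) * A + s * B = (1 - s) * f (x 0) + s * g (x 0) := by
    have hlo' : f (x 0) ≤ A := hlo
    have hhi' : B ≤ g (x 0) := hhi
    rcases eq_or_lt_of_le (add_nonneg (sub_nonneg.2 hlo') (sub_nonneg.2 hhi')) with h | h
    · exact ⟨0, le_rfl, zero_le_one, by linarith⟩
    · refine ⟨(A - f (x 0)) / (A - f (x 0) + (g (x 0) - B)), by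
        apply div_nonneg <;> linarith, by rw [div_le_one h]; linarith, ?_⟩
      have := h.ne'
      field_simp
      ring
  refine ⟨Lagrange.interpolate Finset.univ z fun i => (1 - s) * lo i + s * hi i,
    natDegree_interpolate_le hx.injective _, fun i => ?_⟩
  have hconv : ∀ a b : ℝ, a ≤ b → (a ≤ (1 - s) * a + s * b ∧ (1 - s) * a + s * b ≤ b) ∧
      (a ≤ (1 - s) * b + s * a ∧ (1 - s) * b + s * a ≤ b) := fun a b hab =>
    ⟨⟨by nlinarith, by nlinarith⟩, by nlinarith, by nlinarith⟩
  refine Fin.cases ?_ (fun i => ?_) i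
  · have : (Lagrange.interpolate Finset.univ z fun i => (1 - s) * lo i + s * hi i).eval (x 0) =
        (1 - s) * f (x 0) + s * g (x 0) := by
      rw [eval_interpolate_eq_sum_lagC, ← hs, hA, hB, Finset.mul_sum, Finset.mul_sum,
        ← Finset.sum_add_distrib]
      exact Finset.sum_congr rfl fun i _ => by ring
    rw [this]
    exact (hconv _ _ (hfg 0)).1
  · have : (Lagrange.interpolate Finset.univ z fun i => (1 - s) * lo i + s * hi i).eval
        (x i.succ) = (1 - s) * lo i + s * hi i :=
      Lagrange.eval_interpolate_at_node _ hx.injective.injOn (Finset.mem_univ i)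
    rw [this]
    by_cases h : Odd ((i : ℕ) + 1)
    · simp only [lo, hi, if_pos h]
      exact (hconv _ _ (hfg _)).2
    · simp only [lo, hi, if_neg h]
      exact (hconv _ _ (hfg _)).1

/-- A Helly-type theorem: a band over an infinite set contains a polynomial of degree at most `n`
as soon as this holds over any `n + 2` points. -/
theorem exists_separating_polynomial_of_card {n : ℕ} {I : Set ℝ} (hI : I.Infinite) {f g : ℝ → ℝ}
    (h : ∀ s : Finset ℝ, ↑s ⊆ I → s.card = n + 2 → ∃ w : Polynomial ℝ, w.natDegree ≤ n ∧
      ∀ x ∈ s, f x ≤ w.eval x ∧ w.eval x ≤ g x) :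
    ∃ w : Polynomial ℝ, w.natDegree ≤ n ∧ ∀ x ∈ I, f x ≤ w.eval x ∧ w.eval x ≤ g x := by
  classical
  have : Infinite I := hI.to_subtype
  let e : Fin (n + 1) → I := fun i => Infinite.natEmbedding I i
  let z : Fin (n + 1) → ℝ := fun i => e i
  have hz : Function.Injective z := fun i j hij =>
    Fin.ext ((Infinite.natEmbedding I).injective (Subtype.ext hij))
  let ev : ℝ → (Fin (n + 1) → ℝ) →ₗ[ℝ] ℝ := fun x =>
    (Polynomial.leval x).comp (Lagrange.interpolate Finset.univ z)
  let F : I → Set (Fin (n + 1) → ℝ) := fun x => ev x ⁻¹' Set.Icc (f x) (g x)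
  have hev_poly : ∀ w : Polynomial ℝ, w.natDegree ≤ n → ∀ x,
      ev x (fun i => w.eval (z i)) = w.eval x := fun w hw x => by
    rw [eval_eq_sum_lagC hz hw x, ← eval_interpolate_eq_sum_lagC]
    rfl
  have hev_node : ∀ v i, ev (z i) v = v i := fun v i =>
    Lagrange.eval_interpolate_at_node _ hz.injOn (Finset.mem_univ i)
  have hfin : ∀ u : Finset I, (⋂ x ∈ u, F x).Nonempty := by
    intro u
    refine Convex.helly_theorem' (𝕜 := ℝ)
      (fun x _ => (convex_Icc (f x) (g x)).linear_preimage (ev x)) fun J _ hJ => ?_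
    rw [Module.finrank_fin_fun] at hJ
    obtain ⟨J', hJJ', hcard⟩ := Infinite.exists_superset_card_eq J (n + 2) hJ
    obtain ⟨w, hw, hwx⟩ := h (J'.map (Function.Embedding.subtype _)) (by simp)
      (by rw [Finset.card_map, hcard])
    refine ⟨fun i => w.eval (z i), Set.mem_iInter₂.2 fun x hx => ?_⟩
    change ev x _ ∈ Set.Icc (f x) (g x)
    rw [hev_poly w hw]
    exact hwx x (Finset.mem_map_of_mem (Function.Embedding.subtype _) (hJJ' hx))
  let K : Set (Fin (n + 1) → ℝ) := Set.univ.pi fun i => Set.Icc (f (z i)) (g (z i))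
  have hK : IsCompact K := isCompact_univ_pi fun _ => isCompact_Icc
  obtain ⟨v, -, hv⟩ := hK.inter_iInter_nonempty F
    (fun x => isClosed_Icc.preimage (ev x).continuous_of_finiteDimensional) fun u => by
      obtain ⟨v, hv⟩ := hfin (u ∪ Finset.univ.image e)
      rw [Set.mem_iInter₂] at hv
      refine ⟨v, fun i _ => ?_,
        Set.mem_iInter₂.2 fun x hx => hv x (Finset.mem_union_left _ hx)⟩
      rw [← hev_node v i]
      exact hv (e i) (Finset.mem_union_right _ (Finset.mem_image_of_mem _ (Finset.mem_univ i)))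
  exact ⟨Lagrange.interpolate Finset.univ z v, natDegree_interpolate_le hz v,
    fun x hx => Set.mem_iInter.1 hv ⟨x, hx⟩⟩

/-- `f, g : I → ℝ` can be separated by a polynomial of degree at most `n` iff
`f(b) ≤ g(b)` at the right endpoint `b` of `I` (if it exists and belongs to `I`) and
for all `x₀ ≤ x₁ < x₂ < ⋯ < x_{n+1}` in `I` the two separation inequalities hold.
(Here index `i` of the paper, running through `1, …, n+1`, corresponds to `(i : Fin (n+1)) + 1`.) -/
theorem stmt_2 (n : ℕ) (I : Set ℝ) (hI : I.OrdConnected) (f g : ℝ → ℝ) :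
    (∃ w : Polynomial ℝ, w.natDegree ≤ n ∧
        ∀ x ∈ I, f x ≤ w.eval x ∧ w.eval x ≤ g x) ↔
    ((∀ b ∈ I, (∀ x ∈ I, x ≤ b) → f b ≤ g b) ∧
      ∀ x : Fin (n + 2) → ℝ, (∀ i, x i ∈ I) → x 0 ≤ x 1 →
        StrictMono (fun i : Fin (n + 1) => x i.succ) →
        (f (x 0) ≤ ∑ i : Fin (n + 1), lagC (x 0) (fun j => x j.succ) i *
            (if Odd ((i : ℕ) + 1) then g (x i.succ) else f (x i.succ)) ∧
         g (x 0) ≥ ∑ i : Fin (n + 1), lagC (x 0) (fun j => x j.succ) i *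
            (if Odd ((i : ℕ) + 1) then f (x i.succ) else g (x i.succ)))) := by
  constructor
  · rintro ⟨w, hw, hsep⟩
    refine ⟨fun b hb _ => (hsep b hb).1.trans (hsep b hb).2, fun x hxI hx01 hx => ?_⟩
    have hle : ∀ j : Fin (n + 1), x 0 ≤ x j.succ := fun j =>
      hx01.trans (hx.monotone (Fin.zero_le j))
    have hsgn := neg_one_pow_mul_lagC_nonneg hx hle
    have hw0 := eval_eq_sum_lagC hx.injective hw (x 0)
    constructor
    · refine (hsep _ (hxI 0)).1.trans (hw0.trans_le (Finset.sum_le_sum fun i _ => ?_))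
      have hi := hsgn i
      have hs := hsep _ (hxI i.succ)
      rcases Nat.even_or_odd (i : ℕ) with he | ho
      · rw [he.neg_one_pow, one_mul] at hi
        rw [if_pos he.add_one]
        exact mul_le_mul_of_nonneg_left hs.2 hi
      · rw [ho.neg_one_pow, neg_one_mul, neg_nonneg] at hi
        rw [if_neg (Nat.not_odd_iff_even.2 ho.add_one)]
        exact mul_le_mul_of_nonpos_left hs.1 hi
    · refine le_trans (hw0.symm.le.trans' (Finset.sum_le_sum fun i _ => ?_)) (hsep _ (hxI 0)).2
      have hi := hsgn i
      have hs := hsep _ (hxI i.succ)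
      rcases Nat.even_or_odd (i : ℕ) with he | ho
      · rw [he.neg_one_pow, one_mul] at hi
        rw [if_pos he.add_one]
        exact mul_le_mul_of_nonneg_left hs.1 hi
      · rw [ho.neg_one_pow, neg_one_mul, neg_nonneg] at hi
        rw [if_neg (Nat.not_odd_iff_even.2 ho.add_one)]
        exact mul_le_mul_of_nonpos_left hs.2 hi
  · rintro ⟨hend, hpts⟩
    have hfg : ∀ a ∈ I, f a ≤ g a := by
      intro a ha
      by_cases hmax : ∀ x ∈ I, x ≤ a
      · exact hend a ha hmax
      push Not at hmax
      obtain ⟨b, hb, hab⟩ := hmax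
      let z : Fin (n + 1) → ℝ := fun i => a + (i : ℕ) / (n + 1 : ℝ) * (b - a)
      have hz : StrictMono z := fun i j hij => by
        have : ((i : ℕ) : ℝ) < (j : ℕ) := by exact_mod_cast hij
        have := sub_pos.2 hab
        simp only [z]
        gcongr
      have hz0 : z 0 = a := by simp [z]
      have hzI : ∀ i, z i ∈ I := fun i => by
        refine hI.out ha hb ⟨hz0.symm.le.trans (hz.monotone (Fin.zero_le i)), ?_⟩
        have hi : ((i : ℕ) : ℝ) ≤ n + 1 := by exact_mod_cast i.2.le
        have : ((i : ℕ) : ℝ) / (n + 1) ≤ 1 := (div_le_one (by positivity)).2 hi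
        simp only [z]
        nlinarith
      have h := (hpts (Fin.cons a z) (Fin.cases ha hzI)
        (by rw [← Fin.succ_zero_eq_one, Fin.cons_succ, hz0]; rfl) (by simpa using hz)).1
      simp only [Fin.cons_zero, Fin.cons_succ] at h
      have hlag : ∀ i, lagC a z i = if i = 0 then 1 else 0 := fun i => by
        rw [← lagC_node hz.injective i 0, hz0]
      simpa only [hlag, ite_mul, one_mul, zero_mul, Finset.sum_ite_eq', Finset.sum_ite_eq,
        Finset.mem_univ, if_true, hz0, Fin.val_zero, zero_add, odd_one] using h
    rcases I.subsingleton_or_nontrivial with hsub | hnt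
    · rcases hsub.eq_empty_or_singleton with rfl | ⟨a, rfl⟩
      · exact ⟨0, by simp, by simp⟩
      · exact ⟨Polynomial.C (f a), by simp, by simpa using hfg a rfl⟩
    · obtain ⟨a, ha, b, hb, hab⟩ := hnt.exists_lt
      refine exists_separating_polynomial_of_card
        ((Set.Icc_infinite hab).mono (hI.out ha hb)) fun s hs hcard => ?_
      let x := s.orderEmbOfFin hcard
      have hxI : ∀ i, x i ∈ I := fun i => hs (s.orderEmbOfFin_mem hcard i)
      have hx : StrictMono fun i : Fin (n + 1) => x i.succ :=
        x.strictMono.comp (Fin.strictMono_succ)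
      obtain ⟨h1, h2⟩ := hpts x hxI (x.monotone (Fin.zero_le 1)) hx
      obtain ⟨w, hw, hwx⟩ :=
        exists_separating_polynomial_of_points (fun i => hfg _ (hxI i)) hx h1 h2
      refine ⟨w, hw, fun y hy => ?_⟩
      rw [← Finset.mem_coe, ← Finset.range_orderEmbOfFin s hcard] at hy
      obtain ⟨i, rfl⟩ := hy
      exact hwx i
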